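/- arXiv:2003.12859 — 2 statements merged into one kernel-verified Lean document; each statement's English description precedes it below -/
import Mathlib

section
/- Let L ≥ 1 and let a_0, …, a_{L−1} be real numbers. Let T be the L×L symmetric Toeplitz matrix with T_{ij} = a_{|i−j|}, and let C be the L×L circulant matrix with C_{ij} = ã_{(j−i) mod L}, where ã_m = ((L − m)/L) a_m + (m/L) a_{L−m} for m = 1, …, L−1 and ã_0 = a_0. Then ‖T − C‖_F² = 2 Σ_{m=1}^{L−1} (L − m)(m/L)² (a_{L−m} − a_m)². -/
open Finset

lemma toeplitz_sum (g : ℕ → ℝ) (h0 : g 0 = 0) (n : ℕ) :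
    ∑ i ∈ range n, ∑ j ∈ range n, g ((i : ℤ) - (j : ℤ)).natAbs =
      2 * ∑ m ∈ range n, ((n : ℝ) - m) * g m := by
  induction n with
  | zero => simp
  | succ n ih =>
    have hr : ∑ i ∈ range n, g (n - i) = ∑ m ∈ range (n + 1), g m := by
      rw [← Finset.sum_range_reflect g (n + 1), Finset.sum_range_succ]
      simp [h0]
    have h1 : ∑ i ∈ range n, g ((i : ℤ) - (n : ℤ)).natAbs = ∑ i ∈ range n, g (n - i) := by
      refine Finset.sum_congr rfl fun i hi => ?_
      have := Finset.mem_range.1 hi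
      congr 1
      omega
    have h2 : ∑ i ∈ range n, g ((n : ℤ) - (i : ℤ)).natAbs = ∑ i ∈ range n, g (n - i) := by
      refine Finset.sum_congr rfl fun i hi => ?_
      have := Finset.mem_range.1 hi
      congr 1
      omega
    have h3 : ∑ m ∈ range n, (((n + 1 : ℕ) : ℝ) - m) * g m =
        ∑ m ∈ range n, ((n : ℝ) - m) * g m + ∑ m ∈ range n, g m := by
      rw [← Finset.sum_add_distrib]
      refine Finset.sum_congr rfl fun i hi => ?_
      push_cast
      ring
    simp only [Finset.sum_range_succ _ n, Finset.sum_add_distrib]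
    rw [ih, h1, h2, hr, h3, Finset.sum_range_succ]
    simp [h0]
    ring

/-- Frobenius norm identity for the difference between a symmetric Toeplitz matrix and
Pearl's circulant approximation to it. -/
theorem statement9
    (L : ℕ) (hL : 1 ≤ L) (a : ℕ → ℝ)
    (atil : ℕ → ℝ)
    (hatil : ∀ m, atil m = (((L : ℝ) - m) / (L : ℝ)) * a m + ((m : ℝ) / (L : ℝ)) * a (L - m))
    (T C : Matrix (Fin L) (Fin L) ℝ)
    (hT : ∀ i j, T i j = a ((i.val : ℤ) - (j.val : ℤ)).natAbs)
    (hC : ∀ i j, C i j = atil ((((j.val : ℤ) - (i.val : ℤ)) % (L : ℤ)).toNat)) :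
    ∑ i, ∑ j, (T i j - C i j) ^ 2 =
      2 * ∑ m ∈ Finset.Icc 1 (L - 1),
        ((L : ℝ) - (m : ℝ)) * ((m : ℝ) / (L : ℝ)) ^ 2 * (a (L - m) - a m) ^ 2 := by
  have hL0 : (L : ℝ) ≠ 0 := by
    have : L ≠ 0 := by omega
    exact_mod_cast this
  let g : ℕ → ℝ := fun m => ((m : ℝ) / (L : ℝ)) ^ 2 * (a (L - m) - a m) ^ 2
  have g0 : g 0 = 0 := by simp [g]
  have key : ∀ i j : Fin L, (T i j - C i j) ^ 2 = g ((i.val : ℤ) - (j.val : ℤ)).natAbs := by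
    intro i j
    rw [hT, hC, hatil]
    have hi := i.isLt
    have hj := j.isLt
    rcases le_or_gt i.val j.val with h | h
    · obtain ⟨m, hm⟩ := Nat.exists_eq_add_of_le h
      have e1 : ((i.val : ℤ) - (j.val : ℤ)).natAbs = m := by omega
      have e2 : ((((j.val : ℤ) - (i.val : ℤ)) % (L : ℤ)).toNat) = m := by
        rw [Int.emod_eq_of_lt (by omega) (by omega)]
        omega
      rw [e1, e2]
      simp only [g]
      field_simp
      ring
    · obtain ⟨m, hm⟩ := Nat.exists_eq_add_of_le h.le
      have e1 : ((i.val : ℤ) - (j.val : ℤ)).natAbs = m := by omega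
      have e2 : ((((j.val : ℤ) - (i.val : ℤ)) % (L : ℤ)).toNat) = L - m := by
        rw [← Int.add_emod_right, Int.emod_eq_of_lt (by omega) (by omega)]
        omega
      have e3 : L - (L - m) = m := by omega
      have e4 : ((L - m : ℕ) : ℝ) = (L : ℝ) - m := by
        rw [Nat.cast_sub (by omega)]
      rw [e1, e2, e3, e4]
      simp only [g]
      field_simp
      ring
  simp only [key]
  have hs : ∑ i : Fin L, ∑ j : Fin L, g ((i.val : ℤ) - (j.val : ℤ)).natAbs =
      ∑ i ∈ range L, ∑ j ∈ range L, g ((i : ℤ) - (j : ℤ)).natAbs := by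
    rw [Finset.sum_range]
    refine Finset.sum_congr rfl fun i _ => ?_
    rw [Finset.sum_range]
  rw [hs, toeplitz_sum g g0 L]
  congr 1
  symm
  calc _ = ∑ m ∈ Finset.Icc 1 (L - 1), ((L : ℝ) - m) * g m :=
        Finset.sum_congr rfl fun m _ => by simp only [g]; ring
    _ = _ := by
      apply Finset.sum_subset
      · intro m hm
        rw [Finset.mem_Icc] at hm
        rw [Finset.mem_range]
        omega
      · intro m hm hm'
        rw [Finset.mem_range] at hm
        rw [Finset.mem_Icc] at hm'
        have : m = 0 := by omega
        rw [this, g0, mul_zero]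
end

section
/- Let (γ_m)_{m≥0} be a sequence of real numbers with Σ_{m=0}^∞ γ_m² < ∞. For each L, let Γ_L be the L×L symmetric Toeplitz matrix with (Γ_L)_{ij} = γ_{|i−j|}, and let C̃_L be the L×L circulant matrix with (C̃_L)_{ij} = c̃_{(j−i) mod L}, where c̃_m = ((L − m)/L) γ_m + (m/L) γ_{L−m} for m = 0, 1, …, L−1. Then lim_{L→∞} L^{−1/2} ‖Γ_L − C̃_L‖_F = 0. -/
open Filter Finset

lemma aux_count (g : ℕ → ℝ) (hg : ∀ k, 0 ≤ g k) (L : ℕ) :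
    ∑ i ∈ range L, ∑ j ∈ range L, g ((i : ℤ) - (j : ℤ)).natAbs
      ≤ 2 * ∑ k ∈ range L, ((L : ℝ) - k) * g k := by
  induction L with
  | zero => simp
  | succ L ih =>
    have e1 : ∑ i ∈ range (L+1), ∑ j ∈ range (L+1), g ((i : ℤ) - (j : ℤ)).natAbs
        = ∑ i ∈ range L, ∑ j ∈ range L, g ((i : ℤ) - (j : ℤ)).natAbs
          + ∑ i ∈ range L, g ((i : ℤ) - (L : ℤ)).natAbs
          + ∑ i ∈ range (L+1), g ((L : ℤ) - (i : ℤ)).natAbs := by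
      rw [sum_range_succ]
      congr 1
      rw [← sum_add_distrib]
      exact sum_congr rfl fun i _ => sum_range_succ _ _
    have e2 : ∑ i ∈ range (L+1), g ((L : ℤ) - (i : ℤ)).natAbs = ∑ k ∈ range (L+1), g k := by
      rw [← sum_range_reflect g]
      refine sum_congr rfl fun i hi => ?_
      have := mem_range.1 hi
      congr 1
      omega
    have e3 : ∑ i ∈ range L, g ((i : ℤ) - (L : ℤ)).natAbs ≤ ∑ k ∈ range (L+1), g k := by
      rw [← e2, sum_range_succ]
      have : ∑ i ∈ range L, g ((i : ℤ) - (L : ℤ)).natAbs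
          = ∑ i ∈ range L, g ((L : ℤ) - (i : ℤ)).natAbs := by
        refine sum_congr rfl fun i hi => ?_
        congr 1
        omega
      rw [this]
      linarith [hg ((L : ℤ) - (L : ℤ)).natAbs]
    have e4 : ∑ k ∈ range (L+1), (((L+1 : ℕ) : ℝ) - k) * g k
        = ∑ k ∈ range L, ((L : ℝ) - k) * g k + ∑ k ∈ range (L+1), g k := by
      have : ∑ k ∈ range L, ((L : ℝ) - k) * g k = ∑ k ∈ range (L+1), ((L : ℝ) - k) * g k := by
        rw [sum_range_succ]; simp
      rw [this, ← sum_add_distrib]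
      refine sum_congr rfl fun i hi => ?_
      push_cast; ring
    rw [e1, e2, e4]
    linarith

lemma aux_lim (γ : ℕ → ℝ) (h : Summable fun m => (γ m) ^ 2) :
    Tendsto (fun L : ℕ => ∑' k : ℕ, min ((k : ℝ) / L) 1 * γ k ^ 2) atTop (nhds 0) := by
  have := tendsto_tsum_of_dominated_convergence (𝓕 := atTop)
    (f := fun (L : ℕ) (k : ℕ) => min ((k : ℝ) / L) 1 * γ k ^ 2) (g := fun _ => (0 : ℝ)) h
    (fun k => by
      have h1 : Tendsto (fun L : ℕ => (k : ℝ) / L) atTop (nhds 0) :=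
        tendsto_const_div_atTop_nhds_zero_nat _
      have h2 := (h1.min (tendsto_const_nhds (x := (1 : ℝ)))).mul_const (γ k ^ 2)
      simpa using h2)
    (Eventually.of_forall fun L k => by
      have h0 : 0 ≤ min ((k : ℝ) / L) 1 := le_min (by positivity) zero_le_one
      rw [Real.norm_of_nonneg (by positivity)]
      exact mul_le_of_le_one_left (sq_nonneg _) (min_le_right _ _))
  simpa using this

lemma aux_term (t a b : ℝ) (h0 : 0 ≤ t) (h1 : t ≤ 1) :
    (1 - t) * (t ^ 2 * (a - b) ^ 2) ≤ 2 * (t * a ^ 2 + (1 - t) * b ^ 2) := by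
  have hs : (a - b) ^ 2 ≤ 2 * (a ^ 2 + b ^ 2) := by nlinarith [sq_nonneg (a + b)]
  have hc : 0 ≤ (1 - t) * t ^ 2 := mul_nonneg (by linarith) (sq_nonneg _)
  have hc1 : (1 - t) * t ^ 2 ≤ t := by nlinarith [mul_nonneg h0 h0, mul_nonneg (mul_nonneg h0 h0) h0]
  have hc2 : (1 - t) * t ^ 2 ≤ 1 - t := by
    have : t ^ 2 ≤ 1 := by nlinarith
    nlinarith
  have := mul_le_mul_of_nonneg_left hs hc
  have := mul_le_mul_of_nonneg_right hc1 (sq_nonneg a)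
  have := mul_le_mul_of_nonneg_right hc2 (sq_nonneg b)
  nlinarith

/-- Asymptotic equivalence (Frobenius-norm condition) between the population autocovariance
Toeplitz matrix and Pearl's circulant approximation to it, when the autocovariances are
square-summable. -/
theorem statement10
    (γ : ℕ → ℝ) (hγsq : Summable fun m => (γ m) ^ 2)
    (ctil : ℕ → ℕ → ℝ)
    (hctil : ∀ L m, ctil L m =
      (((L : ℝ) - m) / (L : ℝ)) * γ m + ((m : ℝ) / (L : ℝ)) * γ (L - m))
    (Γmat : (L : ℕ) → Matrix (Fin L) (Fin L) ℝ)
    (hΓmat : ∀ L (i j : Fin L), Γmat L i j = γ ((i.val : ℤ) - (j.val : ℤ)).natAbs)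
    (Cmat : (L : ℕ) → Matrix (Fin L) (Fin L) ℝ)
    (hCmat : ∀ L (i j : Fin L), Cmat L i j =
      ctil L ((((j.val : ℤ) - (i.val : ℤ)) % (L : ℤ)).toNat)) :
    Tendsto
      (fun L : ℕ => (Real.sqrt L)⁻¹ *
        Real.sqrt (∑ i, ∑ j, (Γmat L i j - Cmat L i j) ^ 2))
      atTop (nhds 0) := by
  have hent : ∀ (L : ℕ) (i j : Fin L), (Γmat L i j - Cmat L i j) ^ 2 =
      (fun k : ℕ => ((k : ℝ) / L) ^ 2 * (γ k - γ (L - k)) ^ 2)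
        ((i.val : ℤ) - (j.val : ℤ)).natAbs := by
    intro L i j
    have hi := i.2
    have hj := j.2
    have hL : (L : ℝ) ≠ 0 := by
      have : L ≠ 0 := by omega
      exact_mod_cast this
    rw [hΓmat, hCmat, hctil]
    generalize hk : ((i.val : ℤ) - (j.val : ℤ)).natAbs = k
    have hkL : k < L := by omega
    simp only
    rw [← mul_pow]
    congr 1
    by_cases hij : i.val ≤ j.val
    · have : (((j.val : ℤ) - (i.val : ℤ)) % (L : ℤ)).toNat = k := by
        rw [Int.emod_eq_of_lt (by omega) (by omega)]; omega
      rw [this]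
      field_simp
      ring
    · have : (((j.val : ℤ) - (i.val : ℤ)) % (L : ℤ)).toNat = L - k := by
        rw [← Int.add_emod_right, Int.emod_eq_of_lt (by omega) (by omega)]; omega
      rw [this, Nat.sub_sub_self hkL.le, Nat.cast_sub hkL.le]
      field_simp
      ring
  have hbound : ∀ L : ℕ, 0 < L → (L : ℝ)⁻¹ * (∑ i, ∑ j, (Γmat L i j - Cmat L i j) ^ 2)
      ≤ 8 * ∑' k : ℕ, min ((k : ℝ) / L) 1 * γ k ^ 2 := by
    intro L hL0
    have hL : (0 : ℝ) < L := by exact_mod_cast hL0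
    set g : ℕ → ℝ := fun k : ℕ => ((k : ℝ) / L) ^ 2 * (γ k - γ (L - k)) ^ 2 with hg
    have e1 : ∑ i, ∑ j, (Γmat L i j - Cmat L i j) ^ 2
        = ∑ i ∈ range L, ∑ j ∈ range L, g ((i : ℤ) - (j : ℤ)).natAbs := by
      rw [← Fin.sum_univ_eq_sum_range
        (fun i => ∑ j ∈ range L, g ((i : ℤ) - (j : ℤ)).natAbs)]
      refine sum_congr rfl fun i _ => ?_
      rw [← Fin.sum_univ_eq_sum_range (fun j => g ((i.val : ℤ) - (j : ℤ)).natAbs)]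
      exact sum_congr rfl fun j _ => hent L i j
    have e2 := aux_count g (fun k => by positivity) L
    have e3 : (L : ℝ)⁻¹ * ∑ k ∈ range L, ((L : ℝ) - k) * g k ≤
        ∑ k ∈ range (L+1), 2 * ((k : ℝ) / L * γ k ^ 2 + (1 - (k : ℝ) / L) * γ (L - k) ^ 2) := by
      rw [sum_range_succ, mul_sum]
      have hlast : 0 ≤ 2 * ((L : ℝ) / L * γ L ^ 2 + (1 - (L : ℝ) / L) * γ (L - L) ^ 2) := by
        rw [div_self hL.ne']; simp; positivity
      refine le_add_of_le_of_nonneg (sum_le_sum fun k hk => ?_) hlast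
      have hkL : (k : ℝ) ≤ L := by exact_mod_cast (mem_range.1 hk).le
      have := aux_term ((k : ℝ) / L) (γ k) (γ (L - k)) (by positivity) ((div_le_one hL).2 hkL)
      refine le_trans (le_of_eq ?_) this
      simp only [hg]
      field_simp
    have e4 : ∑ k ∈ range (L+1), (1 - (k : ℝ) / L) * γ (L - k) ^ 2
        = ∑ k ∈ range (L+1), (k : ℝ) / L * γ k ^ 2 := by
      rw [← sum_range_reflect (fun k : ℕ => (k : ℝ) / L * γ k ^ 2)]
      refine sum_congr rfl fun k hk => ?_
      have hk' : k ≤ L := by have := mem_range.1 hk; omega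
      have : L + 1 - 1 - k = L - k := by omega
      rw [this, Nat.cast_sub hk']
      field_simp
    rw [← mul_sum, sum_add_distrib, e4] at e3
    have hnn : ∀ k : ℕ, 0 ≤ min ((k : ℝ) / L) 1 * γ k ^ 2 := fun k =>
      mul_nonneg (le_min (by positivity) zero_le_one) (sq_nonneg _)
    have hsum : Summable fun k : ℕ => min ((k : ℝ) / L) 1 * γ k ^ 2 :=
      Summable.of_nonneg_of_le hnn
        (fun k => mul_le_of_le_one_left (sq_nonneg _) (min_le_right _ _)) hγsq
    have e5 : ∑ k ∈ range (L+1), (k : ℝ) / L * γ k ^ 2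
        ≤ ∑' k : ℕ, min ((k : ℝ) / L) 1 * γ k ^ 2 := by
      refine le_trans (le_of_eq ?_) (hsum.sum_le_tsum (range (L+1)) fun k _ => hnn k)
      refine sum_congr rfl fun k hk => ?_
      have hkL : (k : ℝ) ≤ L := by
        have := mem_range.1 hk
        exact_mod_cast (by omega : k ≤ L)
      rw [min_eq_left ((div_le_one hL).2 hkL)]
    rw [e1]
    have e6 := mul_le_mul_of_nonneg_left e2 (inv_nonneg.2 hL.le)
    linarith
  have hlim : Tendsto (fun L : ℕ => (L : ℝ)⁻¹ * (∑ i, ∑ j, (Γmat L i j - Cmat L i j) ^ 2))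
      atTop (nhds 0) := by
    have h8 := (aux_lim γ hγsq).const_mul 8
    rw [mul_zero] at h8
    refine squeeze_zero' (Eventually.of_forall fun L => ?_) ?_ h8
    · positivity
    · filter_upwards [eventually_gt_atTop 0] with L hL using hbound L hL
  have hs := hlim.sqrt
  rw [Real.sqrt_zero] at hs
  refine hs.congr fun L => ?_
  rw [Real.sqrt_mul (by positivity), Real.sqrt_inv]
end
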